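/- Let D be a digraph. If every directed cycle B in D has at least (1/2)·‖B‖ + 1 symmetric arcs, then D has a 3-kernel. -/

import Mathlib

open List

attribute [local instance] Classical.propDecidable

variable {V : Type*}

/-- `l` is the vertex list of a directed path from `u` to `v` in the digraph with arc
relation `A`: the vertices are pairwise distinct, consecutive vertices are joined by
arcs, the path starts at `u` and ends at `v`.  Its length (number of arcs) is
`l.length - 1`. -/
def IsPath (A : V → V → Prop) (u v : V) (l : List V) : Prop :=
  l.Nodup ∧ l.Chain' A ∧ l.head? = some u ∧ l.getLast? = some v

/-- The arcs of a directed path given by its vertex list. -/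
def pathArcs (l : List V) : List (V × V) := l.zip l.tail

/-- The distance from `u` to `v` in the digraph with arc relation `A`: the least number
of arcs on a directed `uv`-path, and `⊤` if there is no such path. -/
noncomputable def ddist (A : V → V → Prop) (u v : V) : ℕ∞ :=
  sInf {n : ℕ∞ | ∃ l : List V, IsPath A u v l ∧ (l.length : ℕ∞) = n + 1}

/-- The arcs of the directed cycle whose vertex list is `l` (consecutive pairs,
including the wrap-around arc from the last vertex to the first). -/
def cycleArcs (l : List V) : List (V × V) := l.zip (l.rotate 1)

/-- `l` is the vertex list of a directed cycle of the digraph with arc relation `A`;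
the length `‖l‖` of the cycle is `l.length`. -/
def IsCycle (A : V → V → Prop) (l : List V) : Prop :=
  2 ≤ l.length ∧ l.Nodup ∧ ∀ p ∈ cycleArcs l, A p.1 p.2

/-- The number of symmetric arcs of the cycle with vertex list `l`. -/
noncomputable def symCount (A : V → V → Prop) (l : List V) : ℕ :=
  (cycleArcs l).countP (fun p => decide (A p.2 p.1))

/-- The `m`-closure of a digraph: there is an arc from `u` to `v` iff `u ≠ v` and the
distance from `u` to `v` in `D` is at most `m`. -/
def mClosure (A : V → V → Prop) (m : ℕ) : V → V → Prop :=
  fun u v => u ≠ v ∧ ddist A u v ≤ (m : ℕ∞)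

/-- A set `S` is `k`-independent if the distance between any two distinct vertices of
`S` is at least `k`. -/
def KIndependent (A : V → V → Prop) (k : ℕ) (S : Set V) : Prop :=
  ∀ u ∈ S, ∀ v ∈ S, u ≠ v → (k : ℕ∞) ≤ ddist A u v

/-- A set `S` is `ℓ`-absorbent if every vertex outside `S` is at distance at most `ℓ`
from some vertex of `S`. -/
def LAbsorbent (A : V → V → Prop) (ℓ : ℕ) (S : Set V) : Prop :=
  ∀ u, u ∉ S → ∃ v ∈ S, ddist A u v ≤ (ℓ : ℕ∞)

/-- A `k`-kernel is a `k`-independent and `(k-1)`-absorbent set. -/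
def IsKKernel (A : V → V → Prop) (k : ℕ) (S : Set V) : Prop :=
  KIndependent A k S ∧ LAbsorbent A (k - 1) S

/-- A kernel is a `2`-kernel, i.e. an independent set that `1`-absorbs every vertex
outside of it. -/
def IsKernel (A : V → V → Prop) (S : Set V) : Prop := IsKKernel A 2 S

/-- A digraph is kernel-perfect if every induced subdigraph has a kernel. -/
def KernelPerfect (A : V → V → Prop) : Prop :=
  ∀ S : Set V, ∃ K : Set S, IsKernel (fun x y : S => A x.1 y.1) K

/-- Weight of an arc: `1` if symmetric, `-1` otherwise. -/
noncomputable def arcW (A : V → V → Prop) (u v : V) : ℤ := if A v u then 1 else -1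

/-- Total weight of a walk. -/
noncomputable def walkW (A : V → V → Prop) : List V → ℤ
  | [] => 0
  | [_] => 0
  | x :: y :: l => arcW A x y + walkW A (y :: l)

theorem walkW_append (A : V → V → Prop) (a : List V) (x : V) (b : List V) :
    walkW A (a ++ x :: b) = walkW A (a ++ [x]) + walkW A (x :: b) := by
  induction a with
  | nil => simp [walkW]
  | cons y a ih =>
    cases a with
    | nil => simp [walkW]
    | cons z a =>
      simp only [List.cons_append, walkW] at ih ⊢
      rw [ih]; ring

theorem isChain_glue (A : V → V → Prop) (a : List V) (x : V) (b : List V) :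
    List.IsChain A (a ++ x :: b) ↔ List.IsChain A (a ++ [x]) ∧ List.IsChain A (x :: b) :=
  List.isChain_split

theorem zip_weight (A : V → V → Prop) (b : List V) (x y : V) :
    walkW A (x :: (b ++ [y])) =
      2 * (((x :: b).zip (b ++ [y])).countP (fun p => decide (A p.2 p.1)) : ℤ) -
        ((b.length : ℤ) + 1) := by
  induction b generalizing x with
  | nil => by_cases h : A y x <;> simp [walkW, arcW, h]
  | cons z b ih =>
    have := ih z
    simp only [List.cons_append, walkW, List.zip_cons_cons] at this ⊢
    rw [this, List.countP_cons]
    by_cases h : A z x <;> simp [arcW, h] <;> ring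

theorem zip_arcs (A : V → V → Prop) (b : List V) (x y : V)
    (h : List.IsChain A (x :: (b ++ [y]))) :
    ∀ p ∈ (x :: b).zip (b ++ [y]), A p.1 p.2 := by
  induction b generalizing x with
  | nil => simpa using h
  | cons z b ih =>
    simp only [List.cons_append, List.isChain_cons_cons] at h
    intro p hp
    simp only [List.cons_append, List.zip_cons_cons, List.mem_cons] at hp
    rcases hp with rfl | hp
    · exact h.1
    · exact ih z h.2 p (by simpa using hp)

theorem closed_pos (A : V → V → Prop) (hloopless : Irreflexive A)
    (hcyc : ∀ l : List V, IsCycle A l →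
      (1 / 2 : ℚ) * l.length + 1 ≤ (symCount A l : ℚ)) (n : ℕ) :
    ∀ (b : List V) (x : V), b.length = n → List.IsChain A (x :: (b ++ [x])) →
      0 < walkW A (x :: (b ++ [x])) := by
  induction n using Nat.strong_induction_on with
  | _ n ih =>
    intro b x hn hch
    by_cases hx : x ∈ b
    · obtain ⟨s, t, rfl⟩ := List.append_of_mem hx
      have e : x :: ((s ++ x :: t) ++ [x]) = (x :: s) ++ x :: (t ++ [x]) := by simp
      rw [e] at hch ⊢
      rw [isChain_glue] at hch
      rw [walkW_append]
      simp only [List.length_append, List.length_cons] at hn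
      have h1 := ih s.length (by omega) s x rfl hch.1
      have h2 := ih t.length (by omega) t x rfl hch.2
      simp only [List.cons_append] at *
      omega
    · by_cases hb : b.Nodup
      · have hne : b ≠ [] := by
          rintro rfl
          simp at hch
          exact hloopless x hch
        have hlen : 1 ≤ b.length := List.length_pos_iff.mpr hne
        have hc : IsCycle A (x :: b) := by
          refine ⟨by simp; omega, List.nodup_cons.mpr ⟨hx, hb⟩, ?_⟩
          have := zip_arcs A b x x hch
          simpa [cycleArcs] using this
        have h := hcyc _ hc
        have hw := zip_weight A b x x
        have hs : symCount A (x :: b) =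
            ((x :: b).zip (b ++ [x])).countP (fun p => decide (A p.2 p.1)) := by
          simp [symCount, cycleArcs]
        rw [← hs] at hw
        rw [hw]
        simp only [List.length_cons] at h
        have h' : ((b.length : ℚ) + 1) + 2 ≤ 2 * (symCount A (x :: b) : ℚ) := by
          push_cast at h; linarith
        have h'' : ((b.length : ℤ) + 1) + 2 ≤ 2 * (symCount A (x :: b) : ℤ) := by
          exact_mod_cast h'
        omega
      · obtain ⟨y, hy⟩ := List.exists_duplicate_iff_not_nodup.mpr hb
        obtain ⟨s, t, r, rfl⟩ : ∃ s t r, b = s ++ y :: (t ++ y :: r) := by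
          clear hb hx hch hn ih
          induction hy with
          | cons_mem h =>
            obtain ⟨t, r, rfl⟩ := List.append_of_mem h
            exact ⟨[], t, r, rfl⟩
          | cons_duplicate h ih =>
            obtain ⟨s, t, r, rfl⟩ := ih
            exact ⟨_ :: s, t, r, rfl⟩
        have e : x :: ((s ++ y :: (t ++ y :: r)) ++ [x]) =
            (x :: s) ++ y :: ((t ++ y :: r) ++ [x]) := by simp
        have e2 : y :: ((t ++ y :: r) ++ [x]) = (y :: t) ++ y :: (r ++ [x]) := by simp
        have e3 : x :: ((s ++ y :: r) ++ [x]) = (x :: s) ++ y :: (r ++ [x]) := by simp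
        rw [e, isChain_glue, e2, isChain_glue A (y :: t)] at hch
        rw [e, walkW_append, e2, walkW_append A (y :: t)]
        simp only [List.length_append, List.length_cons] at hn
        have h1 := ih t.length (by omega) t y rfl hch.2.1
        have h2 := ih (s ++ y :: r).length (by simp; omega) (s ++ y :: r) x rfl (by
          rw [e3, isChain_glue]; exact ⟨hch.1, hch.2.2⟩)
        rw [e3, walkW_append] at h2
        simp only [List.cons_append] at *
        omega

/-- There is a nontrivial walk of nonpositive weight from `u` to `v`. -/
def NegWalk (A : V → V → Prop) (u v : V) : Prop :=
  ∃ m : List V, List.IsChain A (u :: (m ++ [v])) ∧ walkW A (u :: (m ++ [v])) ≤ 0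

theorem NegWalk.comp {A : V → V → Prop} {u v w : V} (h : NegWalk A u v) (h' : NegWalk A v w) :
    NegWalk A u w := by
  obtain ⟨m, hm, hw⟩ := h
  obtain ⟨m', hm', hw'⟩ := h'
  have e : u :: ((m ++ v :: m') ++ [w]) = (u :: m) ++ v :: (m' ++ [w]) := by simp
  refine ⟨m ++ v :: m', ?_, ?_⟩
  · rw [e, isChain_glue]; exact ⟨hm, hm'⟩
  · rw [e, walkW_append]
    simp only [List.cons_append] at *
    omega

theorem kernel_aux [Fintype V] (C R : V → V → Prop) (hC : ∀ u, ¬ C u u)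
    (htr : ∀ u v w, R u v → R v w → R u w)
    (hirr : ∀ u, ¬ R u u) (hCR : ∀ u v, C u v → ¬ C v u → R u v) (n : ℕ) :
    ∀ T : Finset V, T.card = n → ∃ S ⊆ T, (∀ u ∈ S, ∀ v ∈ S, ¬ C u v) ∧
      ∀ u ∈ T, u ∉ S → ∃ v ∈ S, C u v := by
  induction n using Nat.strong_induction_on with
  | _ n ih =>
    intro T hT
    rcases T.eq_empty_or_nonempty with rfl | hne
    · exact ⟨∅, by simp⟩
    · have hwf : WellFounded (fun u v => R v u) := by
        haveI : IsTrans V (fun u v => R v u) := ⟨fun a b c h h' => htr _ _ _ h' h⟩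
        haveI : Std.Irrefl (fun u v : V => R v u) := ⟨fun a => hirr a⟩
        exact Finite.wellFounded_of_trans_of_irrefl _
      obtain ⟨v, hvT, hv⟩ := hwf.has_min (T : Set V) hne
      have hvT' : v ∈ T := hvT
      have hlt : (T.filter (fun u => u ≠ v ∧ ¬ C u v)).card < n := by
        rw [← hT]
        apply Finset.card_lt_card
        refine ⟨Finset.filter_subset _ _, fun h => ?_⟩
        have := h hvT'
        simp at this
      obtain ⟨S, hS, hind, habs⟩ := ih _ hlt _ rfl
      refine ⟨insert v S, ?_, ?_, ?_⟩
      · intro u hu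
        rcases Finset.mem_insert.mp hu with rfl | hu
        · exact hvT'
        · exact (Finset.mem_filter.mp (hS hu)).1
      · have key : ∀ u ∈ S, ¬ C u v ∧ ¬ C v u := by
          intro u hu
          obtain ⟨h1, h2, h3⟩ := Finset.mem_filter.mp (hS hu)
          exact ⟨h3, fun h => hv u h1 (hCR _ _ h h3)⟩
        intro a ha b hb
        rcases Finset.mem_insert.mp ha with rfl | ha' <;>
          rcases Finset.mem_insert.mp hb with rfl | hb'
        · exact hC _
        · exact (key _ hb').2
        · exact (key _ ha').1
        · exact hind _ ha' _ hb'
      · intro u hu huS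
        simp only [Finset.mem_insert, not_or] at huS
        by_cases h : C u v
        · exact ⟨v, by simp, h⟩
        · obtain ⟨w, hw, hc⟩ := habs u (by simp [hu, huS.1, h]) huS.2
          exact ⟨w, by simp [hw], hc⟩

theorem ddist_le_two_cases (A : V → V → Prop) (u v : V) (hne : u ≠ v)
    (h : ddist A u v ≤ (2 : ℕ)) : A u v ∨ ∃ w, A u w ∧ A w v := by
  have hn : {n : ℕ∞ | ∃ l : List V, IsPath A u v l ∧ (l.length : ℕ∞) = n + 1}.Nonempty := by
    by_contra hcon
    rw [Set.not_nonempty_iff_eq_empty] at hcon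
    rw [ddist, hcon] at h
    simp at h
  obtain ⟨l, ⟨-, hch, hh, hl⟩, hlen⟩ := csInf_mem hn
  have hl3 : l.length ≤ 3 := by
    have : (l.length : ℕ∞) ≤ (2 : ℕ) + 1 := by
      rw [hlen]; exact add_le_add_left h 1
    exact_mod_cast this
  change List.IsChain A l at hch
  match l, hl3 with
  | [], _ => simp at hh
  | [a], _ => simp at hh hl; exact absurd (hh.symm.trans hl) hne
  | [a, b], _ => simp at hh hl hch; subst hh hl; exact Or.inl hch
  | [a, b, c], _ => simp at hh hl hch; subst hh hl; exact Or.inr ⟨b, hch⟩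
  | _ :: _ :: _ :: _ :: _, h => simp at h; omega

theorem ddist_le_one (A : V → V → Prop) (u v : V) (hne : u ≠ v)
    (h : A u v) : ddist A u v ≤ (2 : ℕ) := by
  refine le_trans (sInf_le (a := 1) ⟨[u, v], ⟨by simp [hne], ?_, by simp, by simp⟩, ?_⟩) ?_
  · change List.IsChain A _
    simpa using h
  · simp; norm_num
  · norm_num

theorem ddist_le_two (A : V → V → Prop) (hloopless : Irreflexive A) (u w v : V) (hne : u ≠ v)
    (h : A u w) (h' : A w v) : ddist A u v ≤ (2 : ℕ) := by
  have h1 : u ≠ w := by rintro rfl; exact hloopless _ h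
  have h2 : w ≠ v := by rintro rfl; exact hloopless _ h'
  refine sInf_le ⟨[u, w, v], ⟨by simp [hne, h1, h2], ?_, by simp, by simp⟩, ?_⟩
  · change List.IsChain A _
    simpa using ⟨h, h'⟩
  · simp; norm_num

/-- If every directed cycle `B` of `D` has at least `(1/2)·‖B‖ + 1` symmetric arcs,
then `D` has a `3`-kernel. -/
theorem has_3kernel [Fintype V] (A : V → V → Prop) (hloopless : Irreflexive A)
    (hcyc : ∀ l : List V, IsCycle A l →
      (1 / 2 : ℚ) * l.length + 1 ≤ (symCount A l : ℚ)) :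
    ∃ S : Set V, IsKKernel A 3 S := by
  have hCR : ∀ u v, mClosure A 2 u v → ¬ mClosure A 2 v u → NegWalk A u v := by
    rintro u v ⟨hne, hd⟩ hn
    rcases ddist_le_two_cases A u v hne hd with h | ⟨w, h1, h2⟩
    · have : ¬ A v u := fun h' => hn ⟨hne.symm, ddist_le_one A v u hne.symm h'⟩
      exact ⟨[], by simpa using h, by simp [walkW, arcW, this]⟩
    · have : ¬ (A v w ∧ A w u) := fun h' =>
        hn ⟨hne.symm, ddist_le_two A hloopless v w u hne.symm h'.1 h'.2⟩
      refine ⟨[w], by simpa using ⟨h1, h2⟩, ?_⟩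
      by_cases ha : A v w <;> by_cases hb : A w u <;> simp [walkW, arcW, ha, hb]
      exact this ⟨ha, hb⟩
  obtain ⟨S, -, hind, habs⟩ := kernel_aux (mClosure A 2) (NegWalk A) (fun u h => h.1 rfl)
    (fun u v w h h' => h.comp h')
    (fun u ⟨m, hm, hw⟩ => absurd (closed_pos A hloopless hcyc _ m u rfl hm) (not_lt.mpr hw))
    hCR _ Finset.univ rfl
  refine ⟨(S : Set V), ?_, ?_⟩
  · intro u hu v hv hne
    by_contra hlt
    refine hind u hu v hv ⟨hne, ?_⟩
    have : ddist A u v < ((2 : ℕ) : ℕ∞) + 1 := by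
      have := not_le.mp hlt
      norm_num at this ⊢
      exact this
    exact Order.le_of_lt_add_one this
  · intro u hu
    obtain ⟨v, hv, hc⟩ := habs u (Finset.mem_univ _) hu
    exact ⟨v, hv, hc.2⟩
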